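/- arXiv:1206.3204 — 2 statements merged into one kernel-verified Lean document; each statement's English description precedes it below -/
import Mathlib

section
/- Fix a cluster index r and a nonempty proper subset X ⊊ T_r, and write μ(X) = (1/|X|)·Σ_{i∈X} A_i. Let A_r be the n_r×d submatrix of A consisting of the rows indexed by T_r, and let C_r be the n_r×d matrix all of whose rows equal μ_r. Then |X|·‖μ(X) − μ_r‖ = (n_r − |X|)·‖μ(T_r ∖ X) − μ_r‖, and |X|·‖μ(X) − μ_r‖ ≤ √|X|·‖A_r − C_r‖. -/
open Finset
open scoped Classical

noncomputable section

/-- Spectral (ℓ₂ operator) norm of a real matrix. -/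
def specNorm {m p : Type*} [Fintype m] [Fintype p] [DecidableEq p] (M : Matrix m p ℝ) : ℝ :=
  ‖LinearMap.toContinuousLinearMap (Matrix.toEuclideanLin M)‖

/-- Frobenius norm of a real matrix. -/
def frobNorm {m p : Type*} [Fintype m] [Fintype p] (M : Matrix m p ℝ) : ℝ :=
  Real.sqrt (∑ i, ∑ j, (M i j) ^ 2)

variable {n d k : ℕ}

/-- The i-th row of a matrix, viewed as a point of Euclidean space. -/
def row (M : Matrix (Fin n) (Fin d) ℝ) (i : Fin n) : EuclideanSpace ℝ (Fin d) :=
  (WithLp.equiv 2 (Fin d → ℝ)).symm (M i)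

/-- The set of indices assigned to cluster `r` by the clustering `τ`. -/
def cluster (τ : Fin n → Fin k) (r : Fin k) : Finset (Fin n) :=
  Finset.univ.filter fun i => τ i = r

/-- The size `n_r` of cluster `r`. -/
def clusterSize (τ : Fin n → Fin k) (r : Fin k) : ℕ := (cluster τ r).card

/-- The mean of the rows of `M` indexed by `S`. -/
def meanOf (M : Matrix (Fin n) (Fin d) ℝ) (S : Finset (Fin n)) : EuclideanSpace ℝ (Fin d) :=
  (S.card : ℝ)⁻¹ • ∑ i ∈ S, row M i

/-- The mean `μ_r` of cluster `r`. -/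
def mu (A : Matrix (Fin n) (Fin d) ℝ) (τ : Fin n → Fin k) (r : Fin k) :
    EuclideanSpace ℝ (Fin d) :=
  meanOf A (cluster τ r)

/-- The matrix `C` whose i-th row is the mean of the cluster containing `i`. -/
def centerMatrix (A : Matrix (Fin n) (Fin d) ℝ) (τ : Fin n → Fin k) :
    Matrix (Fin n) (Fin d) ℝ :=
  fun i j => mu A τ (τ i) j

/-- `Δ_r = (1/√n_r) · min {√k·‖A−C‖, ‖A−C‖_F}`. -/
def Delta (A : Matrix (Fin n) (Fin d) ℝ) (τ : Fin n → Fin k) (r : Fin k) : ℝ :=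
  (Real.sqrt (clusterSize τ r))⁻¹ *
    min (Real.sqrt k * specNorm (A - centerMatrix A τ)) (frobNorm (A - centerMatrix A τ))

end

theorem card_smul_meanOf_sub {n d : ℕ} (A : Matrix (Fin n) (Fin d) ℝ) {S : Finset (Fin n)}
    (hS : S.Nonempty) (c : EuclideanSpace ℝ (Fin d)) :
    (S.card : ℝ) • (meanOf A S - c) = ∑ i ∈ S, (row A i - c) := by
  have h : (S.card : ℝ) ≠ 0 := by exact_mod_cast hS.card_ne_zero
  rw [smul_sub, meanOf, smul_inv_smul₀ h, Finset.sum_sub_distrib, Finset.sum_const,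
    Nat.cast_smul_eq_nsmul]

theorem card_mul_norm_meanOf_sub {n d : ℕ} (A : Matrix (Fin n) (Fin d) ℝ) {S : Finset (Fin n)}
    (hS : S.Nonempty) (c : EuclideanSpace ℝ (Fin d)) :
    (S.card : ℝ) * ‖meanOf A S - c‖ = ‖∑ i ∈ S, (row A i - c)‖ := by
  rw [← card_smul_meanOf_sub A hS c, norm_smul, Real.norm_natCast]

theorem norm_toEuclideanLin_le_specNorm_mul {m p : Type*} [Fintype m] [Fintype p] [DecidableEq p]
    (M : Matrix m p ℝ) (v : EuclideanSpace ℝ p) :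
    ‖Matrix.toEuclideanLin M v‖ ≤ specNorm M * ‖v‖ :=
  (LinearMap.toContinuousLinearMap (Matrix.toEuclideanLin M)).le_opNorm v

/-- A sum of `Y.card` rows of `M` has norm at most `√Y.card` times the spectral norm of `M`. -/
theorem norm_sum_rows_le {m p : Type*} [Fintype m] [Fintype p] [DecidableEq p]
    (M : Matrix m p ℝ) (Y : Finset m) :
    ‖∑ i ∈ Y, WithLp.toLp 2 (M i)‖ ≤ Real.sqrt Y.card * specNorm M := by
  set v : EuclideanSpace ℝ p := ∑ i ∈ Y, WithLp.toLp 2 (M i) with hv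
  have hinner : ‖v‖ ^ 2 = ∑ i ∈ Y, Matrix.toEuclideanLin M v i := by
    rw [← real_inner_self_eq_norm_sq]
    nth_rewrite 1 [hv]
    rw [sum_inner]
    refine Finset.sum_congr rfl fun i _ => ?_
    simp [PiLp.inner_apply, Matrix.toLpLin_apply, Matrix.mulVec, dotProduct, mul_comm]
  have hsq : (∑ i ∈ Y, Matrix.toEuclideanLin M v i) ^ 2
      ≤ Y.card * ‖Matrix.toEuclideanLin M v‖ ^ 2 := by
    refine sq_sum_le_card_mul_sum_sq.trans ?_
    rw [EuclideanSpace.real_norm_sq_eq]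
    gcongr
    exact Finset.subset_univ Y
  have hcs : ‖v‖ ^ 2 ≤ Real.sqrt Y.card * ‖Matrix.toEuclideanLin M v‖ := by
    rw [hinner]
    refine (Real.le_sqrt_of_sq_le hsq).trans_eq ?_
    rw [Real.sqrt_mul (Nat.cast_nonneg _), Real.sqrt_sq (norm_nonneg _)]
  have hle : ‖v‖ * ‖v‖ ≤ Real.sqrt Y.card * specNorm M * ‖v‖ := by
    rw [← sq, mul_assoc]
    exact hcs.trans (mul_le_mul_of_nonneg_left (norm_toEuclideanLin_le_specNorm_mul M v)
      (Real.sqrt_nonneg _))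
  rcases (norm_nonneg v).eq_or_lt with h | h
  · rw [← h]
    exact mul_nonneg (Real.sqrt_nonneg _) (norm_nonneg _)
  · exact le_of_mul_le_mul_right hle h

/-- for a nonempty proper subset `X ⊊ T_r`,
`|X|·‖μ(X) − μ_r‖ = (n_r − |X|)·‖μ(T_r ∖ X) − μ_r‖` and
`|X|·‖μ(X) − μ_r‖ ≤ √|X|·‖A_r − C_r‖`, where `A_r` is the submatrix of rows indexed by `T_r`
and `C_r` has all rows equal to `μ_r`. -/
theorem stmt3 {n d k : ℕ} (hk : 2 ≤ k) (A : Matrix (Fin n) (Fin d) ℝ)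
    (τ : Fin n → Fin k) (hfib : ∀ r, (cluster τ r).Nonempty)
    (r : Fin k) (X : Finset (Fin n))
    (hXsub : X ⊆ cluster τ r) (hXne : X.Nonempty) (hXproper : X ≠ cluster τ r) :
    (X.card : ℝ) * ‖meanOf A X - mu A τ r‖ =
        ((clusterSize τ r : ℝ) - X.card) * ‖meanOf A (cluster τ r \ X) - mu A τ r‖ ∧
      (X.card : ℝ) * ‖meanOf A X - mu A τ r‖ ≤
        Real.sqrt X.card *
          specNorm ((Matrix.of fun (i : cluster τ r) (j : Fin d) => A i.1 j) -
            Matrix.of fun (_ : cluster τ r) (j : Fin d) => mu A τ r j) := by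
  have hT := hXne.mono hXsub
  have hdiff : (cluster τ r \ X).Nonempty :=
    Finset.sdiff_nonempty.2 fun h => hXproper (hXsub.antisymm h)
  rw [card_mul_norm_meanOf_sub A hXne]
  constructor
  · have hzero : ∑ i ∈ cluster τ r, (row A i - mu A τ r) = 0 := by
      rw [← card_smul_meanOf_sub A hT, mu, sub_self, smul_zero]
    have hcard : (clusterSize τ r : ℝ) - X.card = ((cluster τ r \ X).card : ℝ) := by
      rw [Finset.cast_card_sdiff hXsub, clusterSize]
    rw [hcard, card_mul_norm_meanOf_sub A hdiff, ← norm_neg]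
    rw [← Finset.sum_sdiff hXsub] at hzero
    rw [eq_neg_of_add_eq_zero_left hzero]
  · have hrows := norm_sum_rows_le ((Matrix.of fun (i : cluster τ r) (j : Fin d) => A i.1 j) -
      Matrix.of fun (_ : cluster τ r) (j : Fin d) => mu A τ r j) (X.subtype (· ∈ cluster τ r))
    rw [Finset.card_subtype, Finset.filter_true_of_mem hXsub] at hrows
    have hsum : ∑ i ∈ X, (row A i - mu A τ r) = ∑ i ∈ X.subtype (· ∈ cluster τ r),
        (row A i.1 - mu A τ r) :=
      (Finset.sum_subtype_of_mem _ hXsub).symm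
    rw [hsum]
    exact hrows
end

section
/- Assume c ≥ 48, center separation, centers ν_1,…,ν_k ∈ ℝ^d with ‖μ_r − ν_r‖ ≤ 6·Δ_r for every r, and let Â be an n×d real matrix with ‖Â − C‖_F² ≤ 8·n_r·Δ_r² for every r. Let z : {1,…,n} → {1,…,k} be any assignment with ‖Â_i − ν_{z(i)}‖ ≤ ‖Â_i − ν_s‖ for all i and all s. Then for every cluster index s₀, the number of indices i ∈ T_{s₀} with z(i) ≠ s₀ is at most (128/c²)·n_{s₀}. -/
open Finset
open scoped Classical

lemma specNorm_pos {m p : Type*} [Fintype m] [Fintype p] [DecidableEq p] {M : Matrix m p ℝ}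
    (hM : M ≠ 0) : 0 < specNorm M := by
  unfold specNorm
  rw [norm_pos_iff]
  simpa using hM

lemma frobNorm_sq {m p : Type*} [Fintype m] [Fintype p] (M : Matrix m p ℝ) :
    frobNorm M ^ 2 = ∑ i, ∑ j, (M i j) ^ 2 :=
  Real.sq_sqrt (by positivity)

lemma frobNorm_pos {m p : Type*} [Fintype m] [Fintype p] {M : Matrix m p ℝ} (hM : M ≠ 0) :
    0 < frobNorm M := by
  obtain ⟨i, j, hij⟩ : ∃ i j, M i j ≠ 0 := by
    by_contra! h
    exact hM (Matrix.ext h)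
  refine Real.sqrt_pos.2 ?_
  calc 0 < (M i j) ^ 2 := by positivity
    _ ≤ ∑ j, (M i j) ^ 2 :=
      single_le_sum (f := fun j => (M i j) ^ 2) (fun _ _ => sq_nonneg _) (mem_univ j)
    _ ≤ ∑ i, ∑ j, (M i j) ^ 2 :=
      single_le_sum (f := fun i => ∑ j, (M i j) ^ 2)
        (fun _ _ => sum_nonneg fun _ _ => sq_nonneg _) (mem_univ i)

lemma Delta_pos {n d k : ℕ} (A : Matrix (Fin n) (Fin d) ℝ) (τ : Fin n → Fin k)
    (hAC : A ≠ centerMatrix A τ) {r : Fin k} (hr : (cluster τ r).Nonempty) :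
    0 < Delta A τ r := by
  have hM : A - centerMatrix A τ ≠ 0 := sub_ne_zero.2 hAC
  have hn : (0 : ℝ) < clusterSize τ r := by exact_mod_cast hr.card_pos
  have hk : (0 : ℝ) < k := by exact_mod_cast r.pos
  exact mul_pos (inv_pos.2 (Real.sqrt_pos.2 hn))
    (lt_min (mul_pos (Real.sqrt_pos.2 hk) (specNorm_pos hM)) (frobNorm_pos hM))

/-- The squared distances from the rows of `B` to their cluster means sum to the squared Frobenius
norm of `B - C`. -/
lemma sum_sq_norm_row_sub_mu {n d k : ℕ} (A B : Matrix (Fin n) (Fin d) ℝ) (τ : Fin n → Fin k) :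
    ∑ i, ‖row B i - mu A τ (τ i)‖ ^ 2 = frobNorm (B - centerMatrix A τ) ^ 2 := by
  rw [frobNorm_sq]
  refine sum_congr rfl fun i _ => ?_
  simp [EuclideanSpace.real_norm_sq_eq, row, centerMatrix]

/-- A point that is at least as close to `b'` as to `a'` is far from `a`, when `a'` and `b'`
approximate `a` and `b`. -/
lemma norm_sub_le_of_closer {E : Type*} [SeminormedAddCommGroup E] {x a b a' b' : E}
    (h : ‖x - b'‖ ≤ ‖x - a'‖) : ‖a - b‖ ≤ ‖a - a'‖ + ‖b - b'‖ + 2 * ‖x - a‖ := by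
  have h₁ : ‖a - b‖ ≤ ‖a - x‖ + ‖x - b'‖ + ‖b' - b‖ :=
    (norm_sub_le_norm_sub_add_norm_sub a b' b).trans
      (by gcongr; exact norm_sub_le_norm_sub_add_norm_sub a x b')
  have h₂ := norm_sub_le_norm_sub_add_norm_sub x a a'
  rw [norm_sub_rev a x, norm_sub_rev b' b] at h₁
  linarith

/-- under center separation (with `c ≥ 48`), matched centers `ν_r` and a nearest-center
assignment `z` on the rows of `Â`, each target cluster `T_{s₀}` has at most `(128/c²)·n_{s₀}`
misclassified points. -/
theorem stmt4 {n d k : ℕ} (hk : 2 ≤ k) (A Ahat : Matrix (Fin n) (Fin d) ℝ)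
    (τ : Fin n → Fin k) (hfib : ∀ r, (cluster τ r).Nonempty)
    (c : ℝ) (hc : 48 ≤ c)
    (hAC : A ≠ centerMatrix A τ)
    (hsep : ∀ r s, r ≠ s → c * (Delta A τ r + Delta A τ s) ≤ ‖mu A τ r - mu A τ s‖)
    (ν : Fin k → EuclideanSpace ℝ (Fin d))
    (hν : ∀ r, ‖mu A τ r - ν r‖ ≤ 6 * Delta A τ r)
    (hAhat : ∀ r, frobNorm (Ahat - centerMatrix A τ) ^ 2 ≤
      8 * clusterSize τ r * Delta A τ r ^ 2)
    (z : Fin n → Fin k) (hz : ∀ i s, ‖row Ahat i - ν (z i)‖ ≤ ‖row Ahat i - ν s‖)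
    (s₀ : Fin k) :
    (((cluster τ s₀).filter fun i => z i ≠ s₀).card : ℝ) ≤ 128 / c ^ 2 * clusterSize τ s₀ := by
  have hΔ : ∀ r, 0 < Delta A τ r := fun r => Delta_pos A τ hAC (hfib r)
  have hc0 : 0 < c := by linarith
  set bad := (cluster τ s₀).filter fun i => z i ≠ s₀ with hbad
  have hfar : ∀ i ∈ bad, (c / 4 * Delta A τ s₀) ^ 2 ≤ ‖row Ahat i - mu A τ (τ i)‖ ^ 2 := by
    intro i hi
    obtain ⟨hi₁, hi₂⟩ := mem_filter.1 hi
    rw [(mem_filter.1 hi₁).2]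
    have h₁ := norm_sub_le_of_closer (a := mu A τ s₀) (b := mu A τ (z i)) (hz i s₀)
    have h₂ := hsep s₀ (z i) hi₂.symm
    have h₃ := hν s₀
    have h₄ := hν (z i)
    have hs := hΔ s₀
    have hr := hΔ (z i)
    gcongr
    nlinarith [mul_nonneg (sub_nonneg.2 hc) hs.le, mul_nonneg (sub_nonneg.2 hc) hr.le]
  have hsum : (bad.card : ℝ) * (c / 4 * Delta A τ s₀) ^ 2 ≤
      8 * clusterSize τ s₀ * Delta A τ s₀ ^ 2 := by
    rw [← nsmul_eq_mul]
    calc bad.card • (c / 4 * Delta A τ s₀) ^ 2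
        ≤ ∑ i ∈ bad, ‖row Ahat i - mu A τ (τ i)‖ ^ 2 := card_nsmul_le_sum _ _ _ hfar
      _ ≤ ∑ i, ‖row Ahat i - mu A τ (τ i)‖ ^ 2 :=
        sum_le_univ_sum_of_nonneg fun _ => sq_nonneg _
      _ ≤ _ := (sum_sq_norm_row_sub_mu A Ahat τ).trans_le (hAhat s₀)
  have hΔ2 : 0 < Delta A τ s₀ ^ 2 := pow_pos (hΔ s₀) 2
  have hcancel : (bad.card : ℝ) * (c ^ 2 / 16) ≤ 8 * clusterSize τ s₀ :=
    le_of_mul_le_mul_right (by linarith) hΔ2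
  rw [div_mul_eq_mul_div, le_div_iff₀ (by positivity)]
  linarith
end
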